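/- arXiv:1806.10761 — 3 statements merged into one kernel-verified Lean document; each statement's English description precedes it below -/
import Mathlib

section
/- Consider the relaxed MFMC sample-allocation problem: minimize the variance function V(m_0, …, m_k, α_1, …, α_k) = σ_hi²/m_0 + Σ_{i=1}^k (1/m_{i−1} − 1/m_i)(α_i² σ_i² − 2 α_i ρ_i σ_hi σ_i) over real sample sizes m_0 > 0, m_{i−1} ≤ m_i for i = 1, …, k, and coefficients α ∈ ℝ^k, subject to the budget constraint m_0 c_hi + Σ_{i=1}^k m_i c_i = γ with positive costs c_hi, c_1, …, c_k and budget γ > 0. Assume 1 > ρ_1² > ρ_2² > ⋯ > ρ_k² > 0 (with the convention ρ_{k+1} = 0 and c_0 = c_hi, ρ_0 = 1) and that c_{i−1}/c_i > (ρ_{i−1}² − ρ_i²)/(ρ_i² − ρ_{i+1}²) for i = 1, …, k. Then the point given by α_i* = ρ_i σ_hi/σ_i, r_i = sqrt( c_hi (ρ_i² − ρ_{i+1}²) / ( c_i (1 − ρ_1²) ) ), m_0* = γ / (c_hi + Σ_{i=1}^k r_i c_i), and m_i* = r_i m_0* is feasible and minimizes V over the feasible set. -/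
open Finset

/-- The MFMC estimator variance as a function of (relaxed, real-valued) sample sizes
`m_0, …, m_k` and control variate coefficients `α_1, …, α_k`:
`V(m, α) = σ_hi²/m_0 + ∑_{i=1}^k (1/m_{i−1} − 1/m_i)(α_i² σ_i² − 2 α_i ρ_i σ_hi σ_i)`. -/
noncomputable def mfmcVar (k : ℕ) (σhi : ℝ) (σ ρ : ℕ → ℝ) (m α : ℕ → ℝ) : ℝ :=
  σhi ^ 2 / m 0 + ∑ i ∈ Finset.Icc 1 k,
    (1 / m (i - 1) - 1 / m i) * (α i ^ 2 * σ i ^ 2 - 2 * α i * ρ i * σhi * σ i)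

/-- Feasibility for the relaxed MFMC sample-allocation problem:
`m_0 > 0`, `m_{i−1} ≤ m_i` for `i = 1, …, k`, and the budget constraint
`m_0 c_hi + ∑_{i=1}^k m_i c_i = γ`. -/
def mfmcFeasible (k : ℕ) (chi γ : ℝ) (c : ℕ → ℝ) (m : ℕ → ℝ) : Prop :=
  0 < m 0 ∧ (∀ i ∈ Finset.Icc 1 k, m (i - 1) ≤ m i) ∧
    m 0 * chi + ∑ i ∈ Finset.Icc 1 k, m i * c i = γ

/-- Summation by parts for the telescoping weights `x (i - 1) - x i`. -/
theorem mul_sub_sum_Icc_sub_mul (x q : ℕ → ℝ) (n : ℕ) :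
    x 0 * q 0 - ∑ i ∈ Finset.Icc 1 n, (x (i - 1) - x i) * q i =
      x 0 * (q 0 - q 1) + ∑ i ∈ Finset.Icc 1 n, x i * (q i - q (i + 1)) + x n * q (n + 1) := by
  induction n with
  | zero => simp; ring
  | succ n ih =>
    rw [Finset.sum_Icc_succ_top (by omega), Finset.sum_Icc_succ_top (by omega)]
    simp only [Nat.add_sub_cancel]
    linear_combination ih

/-- Sample sizes that are monotone from a positive `m 0` are positive. -/
theorem mfmcFeasible.pos {k : ℕ} {chi γ : ℝ} {c m : ℕ → ℝ} (h : mfmcFeasible k chi γ c m)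
    {j : ℕ} (hj : j ≤ k) : 0 < m j := by
  induction j with
  | zero => exact h.1
  | succ j ih =>
    exact (ih (by omega)).trans_le (h.2.1 (j + 1) (Finset.mem_Icc.2 ⟨by omega, hj⟩))

/-- For optimal control variate coefficients the variance is a positive combination of the
reciprocal sample sizes. -/
theorem mfmcVar_of_eq {k : ℕ} {σhi : ℝ} {σ ρ m α : ℕ → ℝ}
    (hσ : ∀ i ∈ Finset.Icc 1 k, 0 < σ i) (hρ0 : ρ 0 = 1) (hρlast : ρ (k + 1) = 0)
    (hα : ∀ i ∈ Finset.Icc 1 k, α i = ρ i * σhi / σ i) :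
    mfmcVar k σhi σ ρ m α = σhi ^ 2 * ((ρ 0 ^ 2 - ρ 1 ^ 2) / m 0 +
      ∑ i ∈ Finset.Icc 1 k, (ρ i ^ 2 - ρ (i + 1) ^ 2) / m i) := by
  have habel := mul_sub_sum_Icc_sub_mul (fun i => 1 / m i) (fun i => ρ i ^ 2) k
  have hsum : ∑ i ∈ Finset.Icc 1 k,
      (1 / m (i - 1) - 1 / m i) * (α i ^ 2 * σ i ^ 2 - 2 * α i * ρ i * σhi * σ i) =
      -σhi ^ 2 * ∑ i ∈ Finset.Icc 1 k, (1 / m (i - 1) - 1 / m i) * ρ i ^ 2 := by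
    rw [Finset.mul_sum]
    refine Finset.sum_congr rfl fun i hi => ?_
    have hασ : α i * σ i = ρ i * σhi := by
      rw [hα i hi, div_mul_cancel₀ _ (hσ i hi).ne']
    linear_combination (1 / m (i - 1) - 1 / m i) * (α i * σ i - ρ i * σhi) * hασ
  have hdiv : ∑ i ∈ Finset.Icc 1 k, (ρ i ^ 2 - ρ (i + 1) ^ 2) / m i =
      ∑ i ∈ Finset.Icc 1 k, 1 / m i * (ρ i ^ 2 - ρ (i + 1) ^ 2) :=
    Finset.sum_congr rfl fun i _ => by ring
  rw [mfmcVar, hsum, hdiv]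
  simp only [hρlast, hρ0] at habel ⊢
  linear_combination σhi ^ 2 * habel

/-- Completing the square in each control variate coefficient. -/
theorem mfmcVar_le_of_eq {k : ℕ} {σhi chi γ : ℝ} {σ ρ c m α β : ℕ → ℝ}
    (hσ : ∀ i ∈ Finset.Icc 1 k, 0 < σ i) (hm : mfmcFeasible k chi γ c m)
    (hβ : ∀ i ∈ Finset.Icc 1 k, β i = ρ i * σhi / σ i) :
    mfmcVar k σhi σ ρ m β ≤ mfmcVar k σhi σ ρ m α := by
  unfold mfmcVar
  refine add_le_add_right (Finset.sum_le_sum fun i hi => mul_le_mul_of_nonneg_left ?_ ?_) _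
  rotate_left
  · have hik := Finset.mem_Icc.1 hi
    exact sub_nonneg.2 (one_div_le_one_div_of_le (hm.pos (by omega)) (hm.2.1 i hi))
  · have hβσ : β i * σ i = ρ i * σhi := by
      rw [hβ i hi, div_mul_cancel₀ _ (hσ i hi).ne']
    nlinarith [sq_nonneg (α i * σ i - ρ i * σhi)]

/-- The tangent line of `x ↦ d / x` at `y`, where `d = l * c * y ^ 2`, lies below the graph. -/
theorem tangent_le_div {l c d x y : ℝ} (hl : 0 ≤ l) (hc : 0 ≤ c) (hx : 0 < x)
    (hd : d = l * c * y ^ 2) : d / y + l * (y * c - x * c) ≤ d / x := by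
  have h : d / x - (d / y + l * (y * c - x * c)) = l * c * (y - x) ^ 2 / x := by
    rw [hd]; field_simp; ring
  have : 0 ≤ l * c * (y - x) ^ 2 / x := by positivity
  linarith

/-- The point `α_i* = ρ_i σ_hi/σ_i`, `r_i = √(c_hi(ρ_i² − ρ_{i+1}²)/(c_i(1 − ρ_1²)))`,
`m_0* = γ/(c_hi + ∑ r_i c_i)`, `m_i* = r_i m_0*` is feasible and minimizes the MFMC
variance `V` over the feasible set, under the assumptions
`1 > ρ_1² > ⋯ > ρ_k² > 0` (with `ρ_0 = 1`, `ρ_{k+1} = 0`, `c_0 = c_hi`) and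
`c_{i−1}/c_i > (ρ_{i−1}² − ρ_i²)/(ρ_i² − ρ_{i+1}²)`. -/
theorem mfmc_optimal_allocation
    (k : ℕ) (hk : 1 ≤ k)
    (σhi : ℝ) (hσhi : 0 < σhi)
    (σ ρ c : ℕ → ℝ)
    (hσ : ∀ i ∈ Finset.Icc 1 k, 0 < σ i)
    (chi : ℝ) (hchi : 0 < chi)
    (hc : ∀ i ∈ Finset.Icc 1 k, 0 < c i)
    (γ : ℝ) (hγ : 0 < γ)
    (hρ0 : ρ 0 = 1) (hρlast : ρ (k + 1) = 0) (hc0 : c 0 = chi)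
    (hρdec : ∀ i ∈ Finset.Icc 1 k, ρ i ^ 2 < ρ (i - 1) ^ 2)
    (hρpos : 0 < ρ k ^ 2)
    (hcost : ∀ i ∈ Finset.Icc 1 k,
      (ρ (i - 1) ^ 2 - ρ i ^ 2) / (ρ i ^ 2 - ρ (i + 1) ^ 2) < c (i - 1) / c i)
    (αstar : ℕ → ℝ) (hαstar : ∀ i ∈ Finset.Icc 1 k, αstar i = ρ i * σhi / σ i)
    (r : ℕ → ℝ)
    (hr : ∀ i ∈ Finset.Icc 1 k,
      r i = Real.sqrt (chi * (ρ i ^ 2 - ρ (i + 1) ^ 2) / (c i * (1 - ρ 1 ^ 2))))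
    (m0 : ℝ) (hm0 : m0 = γ / (chi + ∑ i ∈ Finset.Icc 1 k, r i * c i))
    (mstar : ℕ → ℝ) (hmstar0 : mstar 0 = m0)
    (hmstar : ∀ i ∈ Finset.Icc 1 k, mstar i = r i * m0) :
    mfmcFeasible k chi γ c mstar ∧
      ∀ m α : ℕ → ℝ, mfmcFeasible k chi γ c m →
        mfmcVar k σhi σ ρ mstar αstar ≤ mfmcVar k σhi σ ρ m α := by
  have hdpos : ∀ j ≤ k, 0 < ρ j ^ 2 - ρ (j + 1) ^ 2 := by
    intro j hj
    rcases hj.lt_or_eq with h | rfl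
    · exact sub_pos.2 (hρdec (j + 1) (Finset.mem_Icc.2 ⟨by omega, h⟩))
    · simpa [hρlast] using hρpos
  have hcpos : ∀ j ≤ k, 0 < c j := by
    intro j hj
    rcases Nat.eq_zero_or_pos j with rfl | h
    · rwa [hc0]
    · exact hc j (Finset.mem_Icc.2 ⟨h, hj⟩)
  have hone : 0 < 1 - ρ 1 ^ 2 := by simpa [hρ0] using hdpos 0 k.zero_le
  have hrnn : ∀ i ∈ Finset.Icc 1 k, 0 ≤ r i := fun i hi => hr i hi ▸ Real.sqrt_nonneg _
  have hDpos : 0 < chi + ∑ i ∈ Finset.Icc 1 k, r i * c i :=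
    add_pos_of_pos_of_nonneg hchi
      (Finset.sum_nonneg fun i hi => mul_nonneg (hrnn i hi) (hc i hi).le)
  have hm0pos : 0 < m0 := hm0 ▸ div_pos hγ hDpos
  have hms : ∀ j ≤ k, mstar j =
      Real.sqrt (chi * (ρ j ^ 2 - ρ (j + 1) ^ 2) / (c j * (1 - ρ 1 ^ 2))) * m0 := by
    intro j hj
    rcases Nat.eq_zero_or_pos j with rfl | h
    · rw [hmstar0, hc0, hρ0, zero_add, one_pow, div_self (mul_pos hchi hone).ne', Real.sqrt_one,
        one_mul]
    · have hjm := Finset.mem_Icc.2 ⟨h, hj⟩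
      rw [hmstar j hjm, hr j hjm]
  have hfeas : mfmcFeasible k chi γ c mstar := by
    refine ⟨hmstar0 ▸ hm0pos, fun i hi => ?_, ?_⟩
    · have hik := Finset.mem_Icc.1 hi
      have hi1 : i - 1 + 1 = i := by omega
      have hci := hc i hi
      have hci' := hcpos (i - 1) (by omega)
      have hlt := hcost i hi
      rw [div_lt_div_iff₀ (hdpos i hik.2) hci] at hlt
      rw [hms i hik.2, hms (i - 1) (by omega), hi1]
      refine mul_le_mul_of_nonneg_right (Real.sqrt_le_sqrt ?_) hm0pos.le
      rw [div_le_div_iff₀ (by positivity) (by positivity)]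
      nlinarith [mul_pos (mul_pos hchi hone) (sub_pos.2 hlt)]
    · have hsum : ∑ i ∈ Finset.Icc 1 k, mstar i * c i =
          (∑ i ∈ Finset.Icc 1 k, r i * c i) * m0 := by
        rw [Finset.sum_mul]
        exact Finset.sum_congr rfl fun i hi => by rw [hmstar i hi]; ring
      rw [hsum, hmstar0, mul_comm m0, ← add_mul, hm0, mul_div_cancel₀ _ hDpos.ne']
  refine ⟨hfeas, fun m α hm => ?_⟩
  refine le_trans ?_ (mfmcVar_le_of_eq hσ hm hαstar)
  rw [mfmcVar_of_eq hσ hρ0 hρlast hαstar, mfmcVar_of_eq hσ hρ0 hρlast hαstar]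
  refine mul_le_mul_of_nonneg_left ?_ (sq_nonneg _)
  obtain ⟨l, hl, hld⟩ : ∃ l : ℝ, 0 ≤ l ∧
      ∀ j ≤ k, ρ j ^ 2 - ρ (j + 1) ^ 2 = l * c j * mstar j ^ 2 := by
    refine ⟨(1 - ρ 1 ^ 2) / (chi * m0 ^ 2), by positivity, fun j hj => ?_⟩
    have hd := hdpos j hj
    have hcj := hcpos j hj
    rw [hms j hj, mul_pow, Real.sq_sqrt (by positivity)]
    field_simp
  have htangent : ∀ j ≤ k, (ρ j ^ 2 - ρ (j + 1) ^ 2) / mstar j +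
      l * (mstar j * c j - m j * c j) ≤ (ρ j ^ 2 - ρ (j + 1) ^ 2) / m j := fun j hj =>
    tangent_le_div hl (hcpos j hj).le (hm.pos hj) (hld j hj)
  have hsum := Finset.sum_le_sum fun i (hi : i ∈ Finset.Icc 1 k) =>
    htangent i (Finset.mem_Icc.1 hi).2
  rw [Finset.sum_add_distrib, ← Finset.mul_sum, Finset.sum_sub_distrib] at hsum
  have hzero := htangent 0 k.zero_le
  rw [hc0, zero_add] at hzero
  have hbudget : l * (mstar 0 * chi - m 0 * chi) + l * (∑ i ∈ Finset.Icc 1 k, mstar i * c i -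
      ∑ i ∈ Finset.Icc 1 k, m i * c i) = 0 := by
    linear_combination l * (hfeas.2.2 - hm.2.2)
  linarith
end

section
/- Under the assumptions 1 > ρ_1² > ⋯ > ρ_k² > 0 (convention ρ_{k+1} = 0) and positive costs c_hi, c_1, …, c_k, evaluating the MFMC variance function V at the optimal point (m_0*, …, m_k*, α_1*, …, α_k*) with budget γ yields V* = (c_hi σ_hi² / γ) ( sqrt(1 − ρ_1²) + Σ_{i=1}^k sqrt( (c_i/c_hi)(ρ_i² − ρ_{i+1}²) ) )². Consequently, the ratio of V* to the mean squared error σ_hi² c_hi / γ of the benchmark Monte Carlo estimator that spends the same budget γ entirely on the high-fidelity model equals ( sqrt(1 − ρ_1²) + Σ_{i=1}^k sqrt( (c_i/c_hi)(ρ_i² − ρ_{i+1}²) ) )². -/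
open Finset

/-- Summation by parts over `Icc 1 k`. -/
lemma sum_Icc_sub_mul_by_parts (k : ℕ) (f g : ℕ → ℝ) :
    ∑ i ∈ Icc 1 k, (f (i - 1) - f i) * g i
      = f 0 * g 1 - f k * g (k + 1) - ∑ i ∈ Icc 1 k, f i * (g i - g (i + 1)) := by
  induction k with
  | zero => simp
  | succ n ih =>
    rw [sum_Icc_succ_top (by omega), sum_Icc_succ_top (by omega), ih, Nat.add_sub_cancel]
    ring

/-- With optimal coefficients the MFMC variance is a weighted sum of reciprocal sample sizes. -/
lemma mfmcVar_eq_sum_div (k : ℕ) (σhi : ℝ) (σ ρ m α : ℕ → ℝ)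
    (hσ : ∀ i ∈ Icc 1 k, σ i ≠ 0) (hα : ∀ i ∈ Icc 1 k, α i = ρ i * σhi / σ i)
    (hρ : ρ (k + 1) = 0) :
    mfmcVar k σhi σ ρ m α
      = σhi ^ 2 * ((1 - ρ 1 ^ 2) / m 0
          + ∑ i ∈ Icc 1 k, (ρ i ^ 2 - ρ (i + 1) ^ 2) / m i) := by
  have hterm : ∀ i ∈ Icc 1 k,
      (1 / m (i - 1) - 1 / m i) * (α i ^ 2 * σ i ^ 2 - 2 * α i * ρ i * σhi * σ i)
        = -σhi ^ 2 * ((1 / m (i - 1) - 1 / m i) * ρ i ^ 2) := by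
    intro i hi
    have hασ : α i * σ i = ρ i * σhi := by rw [hα i hi, div_mul_cancel₀ _ (hσ i hi)]
    linear_combination (1 / m (i - 1) - 1 / m i) * (α i * σ i - ρ i * σhi) * hασ
  have hparts := sum_Icc_sub_mul_by_parts k (fun i => 1 / m i) (fun i => ρ i ^ 2)
  have hcomm : ∑ i ∈ Icc 1 k, (ρ i ^ 2 - ρ (i + 1) ^ 2) / m i
      = ∑ i ∈ Icc 1 k, 1 / m i * (ρ i ^ 2 - ρ (i + 1) ^ 2) :=
    sum_congr rfl fun i _ => by ring
  rw [mfmcVar, sum_congr rfl hterm, ← mul_sum, hparts, hcomm, hρ]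
  ring

/-- The sample ratio `√(a d / (c D))` expressed through `√((c / a) d)`. -/
lemma sqrt_ratio_mul_cost {a c d D : ℝ} (ha : 0 < a) (hc : 0 < c) (hD : 0 < D) :
    √(a * d / (c * D)) * c = a / √D * √(c / a * d) := by
  have hrw : c / a * d = (c / a) ^ 2 * D * (a * d / (c * D)) := by field_simp
  rw [hrw, Real.sqrt_mul (by positivity), Real.sqrt_mul (by positivity),
    Real.sqrt_sq (by positivity)]
  field_simp

/-- Dividing `d` by the sample ratio `√(a d / (c D))` gives `√D √((c / a) d)`. -/
lemma div_sqrt_ratio {a c d D : ℝ} (ha : 0 < a) (hc : 0 < c) (hd : 0 < d) (hD : 0 < D) :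
    d / √(a * d / (c * D)) = √D * √(c / a * d) := by
  rw [div_eq_iff (by positivity), ← Real.sqrt_mul hD.le, ← Real.sqrt_mul (by positivity)]
  have hrw : D * (c / a * d) * (a * d / (c * D)) = d ^ 2 := by field_simp
  rw [hrw, Real.sqrt_sq hd.le]

/-- Evaluating the MFMC variance `V` at the optimal point
(`α_i* = ρ_i σ_hi/σ_i`, `r_i = √(c_hi(ρ_i² − ρ_{i+1}²)/(c_i(1 − ρ_1²)))`,
`m_0* = γ/(c_hi + ∑ r_i c_i)`, `m_i* = r_i m_0*`) yields
`V* = (c_hi σ_hi²/γ)(√(1 − ρ_1²) + ∑_{i=1}^k √((c_i/c_hi)(ρ_i² − ρ_{i+1}²)))²`;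
consequently the ratio of `V*` to the benchmark Monte Carlo MSE `σ_hi² c_hi/γ` equals
`(√(1 − ρ_1²) + ∑_{i=1}^k √((c_i/c_hi)(ρ_i² − ρ_{i+1}²)))²`. -/
theorem mfmc_optimal_variance
    (k : ℕ) (hk : 1 ≤ k)
    (σhi : ℝ) (hσhi : 0 < σhi)
    (σ ρ c : ℕ → ℝ)
    (hσ : ∀ i ∈ Finset.Icc 1 k, 0 < σ i)
    (chi : ℝ) (hchi : 0 < chi)
    (hc : ∀ i ∈ Finset.Icc 1 k, 0 < c i)
    (γ : ℝ) (hγ : 0 < γ)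
    (hρ0 : ρ 0 = 1) (hρlast : ρ (k + 1) = 0)
    (hρdec : ∀ i ∈ Finset.Icc 1 k, ρ i ^ 2 < ρ (i - 1) ^ 2)
    (hρpos : 0 < ρ k ^ 2)
    (αstar : ℕ → ℝ) (hαstar : ∀ i ∈ Finset.Icc 1 k, αstar i = ρ i * σhi / σ i)
    (r : ℕ → ℝ)
    (hr : ∀ i ∈ Finset.Icc 1 k,
      r i = Real.sqrt (chi * (ρ i ^ 2 - ρ (i + 1) ^ 2) / (c i * (1 - ρ 1 ^ 2))))
    (m0 : ℝ) (hm0 : m0 = γ / (chi + ∑ i ∈ Finset.Icc 1 k, r i * c i))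
    (mstar : ℕ → ℝ) (hmstar0 : mstar 0 = m0)
    (hmstar : ∀ i ∈ Finset.Icc 1 k, mstar i = r i * m0) :
    mfmcVar k σhi σ ρ mstar αstar
        = chi * σhi ^ 2 / γ *
          (Real.sqrt (1 - ρ 1 ^ 2)
            + ∑ i ∈ Finset.Icc 1 k, Real.sqrt (c i / chi * (ρ i ^ 2 - ρ (i + 1) ^ 2))) ^ 2 ∧
      mfmcVar k σhi σ ρ mstar αstar / (σhi ^ 2 * chi / γ)
        = (Real.sqrt (1 - ρ 1 ^ 2)
            + ∑ i ∈ Finset.Icc 1 k, Real.sqrt (c i / chi * (ρ i ^ 2 - ρ (i + 1) ^ 2))) ^ 2 := by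
  have hD : 0 < 1 - ρ 1 ^ 2 := by
    have := hρdec 1 (mem_Icc.2 ⟨le_rfl, hk⟩)
    norm_num [hρ0] at this ⊢
    linarith
  have hd : ∀ i ∈ Icc 1 k, 0 < ρ i ^ 2 - ρ (i + 1) ^ 2 := by
    intro i hi
    obtain ⟨-, hik⟩ := mem_Icc.1 hi
    rcases hik.eq_or_lt with rfl | hlt
    · simpa [hρlast] using hρpos
    · have := hρdec (i + 1) (mem_Icc.2 ⟨by omega, hlt⟩)
      rw [Nat.add_sub_cancel] at this
      linarith
  have hrc : ∑ i ∈ Icc 1 k, r i * c i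
      = chi / √(1 - ρ 1 ^ 2) * ∑ i ∈ Icc 1 k, √(c i / chi * (ρ i ^ 2 - ρ (i + 1) ^ 2)) := by
    rw [mul_sum]
    exact sum_congr rfl fun i hi => by
      rw [hr i hi, sqrt_ratio_mul_cost hchi (hc i hi) hD]
  have hdm : ∑ i ∈ Icc 1 k, (ρ i ^ 2 - ρ (i + 1) ^ 2) / mstar i
      = √(1 - ρ 1 ^ 2) * (∑ i ∈ Icc 1 k, √(c i / chi * (ρ i ^ 2 - ρ (i + 1) ^ 2))) / m0 := by
    rw [mul_sum, sum_div]
    exact sum_congr rfl fun i hi => by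
      rw [hmstar i hi, ← div_div, hr i hi, div_sqrt_ratio hchi (hc i hi) (hd i hi) hD]
  have hV := mfmcVar_eq_sum_div k σhi σ ρ mstar αstar (fun i hi => (hσ i hi).ne') hαstar hρlast
  rw [hdm, hmstar0, hm0, hrc] at hV
  set T := ∑ i ∈ Icc 1 k, √(c i / chi * (ρ i ^ 2 - ρ (i + 1) ^ 2))
  have hS : 0 < √(1 - ρ 1 ^ 2) := Real.sqrt_pos.2 hD
  have hSS : 1 - ρ 1 ^ 2 = √(1 - ρ 1 ^ 2) ^ 2 := (Real.sq_sqrt hD.le).symm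
  set S := √(1 - ρ 1 ^ 2)
  rw [hSS] at hV
  have hmain : mfmcVar k σhi σ ρ mstar αstar = chi * σhi ^ 2 / γ * (S + T) ^ 2 := by
    rw [hV]
    field_simp
  refine ⟨hmain, ?_⟩
  rw [hmain]
  field_simp
end

section
/- Let f_hi, f_lo : 𝒵 → ℝ and γ > 0, and define the high-fidelity indicator I_hi(z) = 1 if f_hi(z) < 0 and 0 otherwise, and the multifidelity indicator Ĩ(z) = 1 if f_lo(z) < −γ or (|f_lo(z)| ≤ γ and f_hi(z) < 0), and Ĩ(z) = 0 otherwise. If |f_lo(z) − f_hi(z)| ≤ γ for all z ∈ 𝒵, then Ĩ(z) = I_hi(z) for all z ∈ 𝒵; consequently, for any probability measure P on 𝒵 (with f_hi, f_lo measurable), E_P[Ĩ] = E_P[I_hi]. -/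
open MeasureTheory

/-- If the low-fidelity model satisfies `|f_lo(z) − f_hi(z)| ≤ γ` for all `z`, then the
multifidelity indicator `Ĩ` (which evaluates `f_hi` only when `|f_lo(z)| ≤ γ`) agrees
with the high-fidelity failure indicator `I_hi` everywhere; consequently
`E_P[Ĩ] = E_P[I_hi]` for any probability measure `P`. -/
theorem multifidelity_indicator_exact
    {𝒵 : Type*} [MeasurableSpace 𝒵]
    (fhi flo : 𝒵 → ℝ) (hfhi : Measurable fhi) (hflo : Measurable flo)
    (γ : ℝ) (hγ : 0 < γ)
    (herr : ∀ z, |flo z - fhi z| ≤ γ) :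
    (∀ z, (if flo z < -γ ∨ (|flo z| ≤ γ ∧ fhi z < 0) then (1 : ℝ) else 0)
        = (if fhi z < 0 then (1 : ℝ) else 0)) ∧
    ∀ (P : Measure 𝒵), IsProbabilityMeasure P →
      (∫ z, (if flo z < -γ ∨ (|flo z| ≤ γ ∧ fhi z < 0) then (1 : ℝ) else 0) ∂P)
        = ∫ z, (if fhi z < 0 then (1 : ℝ) else 0) ∂P := by
  have h : ∀ z, (if flo z < -γ ∨ (|flo z| ≤ γ ∧ fhi z < 0) then (1 : ℝ) else 0)
      = (if fhi z < 0 then (1 : ℝ) else 0) := by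
    intro z
    obtain ⟨hl, hu⟩ := abs_le.mp (herr z)
    refine if_congr ⟨?_, fun hz => ?_⟩ rfl rfl
    · rintro (hz | hz)
      · linarith
      · exact hz.2
    · rcases lt_or_ge (flo z) (-γ) with hlt | hge
      · exact Or.inl hlt
      · exact Or.inr ⟨abs_le.mpr ⟨hge, by linarith⟩, hz⟩
  exact ⟨h, fun P _ => integral_congr_ae (.of_forall h)⟩
end
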